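/- Under the positivity assumptions Q₁(i) ≥ 0, N₁(i) > 0, G₁(i) ≥ 0 for all i, the symmetric matrix Riccati differential equation with regime switching, dP₁(t,i)/dt = −[P₁A + AᵀP₁ + CᵀP₁C + Q₁ − S₁ᵀÑ₁⁻¹S₁ + Σ_j λ_ij(P₁(t,j) − P₁(t,i))] with terminal condition P₁(T,i) = G₁(i), admits a unique solution on [0,T] which is positive semidefinite for each i, where Ñ₁ = N₁ + D₁ᵀP₁D₁ and S₁ = B₁ᵀP₁ + D₁ᵀP₁C. -/

import Mathlib

open Matrix

/-- Data of the Riccati system. -/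
structure RicData (n m : ℕ) (M : Type*) where
  lam : M → M → ℝ
  A : M → Matrix (Fin n) (Fin n) ℝ
  C : M → Matrix (Fin n) (Fin n) ℝ
  B : M → Matrix (Fin n) (Fin m) ℝ
  D : M → Matrix (Fin n) (Fin m) ℝ
  Q : M → Matrix (Fin n) (Fin n) ℝ
  N : M → Matrix (Fin m) (Fin m) ℝ

namespace RicData

section Algebra

set_option linter.unusedSectionVars false

variable {n m : ℕ} {M : Type*} [Fintype M] (d : RicData n m M)

/-- The matrix `Ñ`. -/
def Nt (X : M → Matrix (Fin n) (Fin n) ℝ) (i : M) : Matrix (Fin m) (Fin m) ℝ :=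
  d.N i + (d.D i)ᵀ * X i * d.D i

/-- The matrix `S`. -/
def S (X : M → Matrix (Fin n) (Fin n) ℝ) (i : M) : Matrix (Fin m) (Fin n) ℝ :=
  (d.B i)ᵀ * X i + (d.D i)ᵀ * X i * d.C i

/-- The (time reversed) Riccati vector field. -/
noncomputable def F (X : M → Matrix (Fin n) (Fin n) ℝ) (i : M) : Matrix (Fin n) (Fin n) ℝ :=
  X i * d.A i + (d.A i)ᵀ * X i + (d.C i)ᵀ * X i * d.C i + d.Q i
    - (d.S X i)ᵀ * (d.Nt X i)⁻¹ * d.S X i + ∑ j, d.lam i j • (X j - X i)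

/-- The standing assumptions. -/
structure Good : Prop where
  lam_nonneg : ∀ i j, i ≠ j → 0 ≤ d.lam i j
  Q_pos : ∀ i, (d.Q i).PosSemidef
  N_pos : ∀ i, (d.N i).PosDef

variable {d}

lemma psd_symm {k : ℕ} {Y : Matrix (Fin k) (Fin k) ℝ} (h : Y.PosSemidef) : Yᵀ = Y := by
  have := h.isHermitian
  rwa [Matrix.IsHermitian, conjTranspose_eq_transpose_of_trivial] at this

lemma psd_conj {k l : ℕ} {Y : Matrix (Fin k) (Fin k) ℝ} (h : Y.PosSemidef)
    (D : Matrix (Fin k) (Fin l) ℝ) : (Dᵀ * Y * D).PosSemidef := by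
  have := h.conjTranspose_mul_mul_same D
  rwa [conjTranspose_eq_transpose_of_trivial] at this

lemma psd_nonneg {k : ℕ} {Y : Matrix (Fin k) (Fin k) ℝ} (h : Y.PosSemidef) (x : Fin k → ℝ) :
    0 ≤ x ⬝ᵥ Y *ᵥ x := by
  simpa using h.dotProduct_mulVec_nonneg x

lemma psd_of {k : ℕ} {Y : Matrix (Fin k) (Fin k) ℝ} (h : Yᵀ = Y)
    (h2 : ∀ x : Fin k → ℝ, 0 ≤ x ⬝ᵥ Y *ᵥ x) : Y.PosSemidef := by
  refine PosSemidef.of_dotProduct_mulVec_nonneg ?_ (by simpa using h2)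
  rwa [Matrix.IsHermitian, conjTranspose_eq_transpose_of_trivial]

lemma symm_dot {k : ℕ} {Y : Matrix (Fin k) (Fin k) ℝ} (h : Yᵀ = Y) (x y : Fin k → ℝ) :
    x ⬝ᵥ Y *ᵥ y = y ⬝ᵥ Y *ᵥ x := by
  rw [dotProduct_mulVec, ← mulVec_transpose, h, dotProduct_comm]

lemma psd_kernel {k : ℕ} {Y : Matrix (Fin k) (Fin k) ℝ} (h : Y.PosSemidef) (x : Fin k → ℝ)
    (hx : x ⬝ᵥ Y *ᵥ x = 0) : Y *ᵥ x = 0 := by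
  have := (h.dotProduct_mulVec_zero_iff x).1 (by simpa using hx)
  exact this

lemma Nt_posDef (hd : d.Good) {X : M → Matrix (Fin n) (Fin n) ℝ} (hX : ∀ i, (X i).PosSemidef)
    (i : M) : (d.Nt X i).PosDef :=
  (hd.N_pos i).add_posSemidef (psd_conj (hX i) _)

lemma F_symm (hd : d.Good) {X : M → Matrix (Fin n) (Fin n) ℝ} (hX : ∀ i, (X i)ᵀ = X i)
    (i : M) : (d.F X i)ᵀ = d.F X i := by
  have hN : (d.Nt X i)ᵀ = d.Nt X i := by
    simp [Nt, transpose_mul, hX, psd_symm (hd.N_pos i).posSemidef, Matrix.mul_assoc]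
  have hs : (∑ j, d.lam i j • (X j - X i))ᵀ = ∑ j, d.lam i j • (X j - X i) := by
    rw [transpose_sum]; simp [hX]
  simp only [F, transpose_add, transpose_sub, hs, transpose_mul, transpose_transpose, hX,
    psd_symm (hd.Q_pos i), transpose_nonsing_inv, hN, Matrix.mul_assoc]
  abel

lemma F_quasi (hd : d.Good) {X : M → Matrix (Fin n) (Fin n) ℝ} (hX : ∀ i, (X i).PosSemidef)
    (i : M) (x : Fin n → ℝ) (hx : x ⬝ᵥ X i *ᵥ x = 0) : 0 ≤ x ⬝ᵥ d.F X i *ᵥ x := by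
  have hk := psd_kernel (hX i) x hx
  have hsym := psd_symm (hX i)
  set v := d.C i *ᵥ x with hv
  set w := (d.D i)ᵀ *ᵥ (X i *ᵥ v) with hw
  set u := (d.Nt X i)⁻¹ *ᵥ w with hu
  have hS : d.S X i *ᵥ x = w := by
    simp [S, add_mulVec, ← mulVec_mulVec, hk, hw, hv]
  have hNu : d.Nt X i *ᵥ u = w := by
    rw [hu, mulVec_mulVec, mul_nonsing_inv, one_mulVec]
    exact isUnit_iff_ne_zero.2 (Nt_posDef hd hX i).det_pos.ne'
  set z := d.D i *ᵥ u with hz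
  have e1 : w ⬝ᵥ u = u ⬝ᵥ d.N i *ᵥ u + z ⬝ᵥ X i *ᵥ z := by
    rw [← hNu, dotProduct_comm, Nt, add_mulVec, dotProduct_add, ← mulVec_mulVec, ← mulVec_mulVec,
      ← hz, dotProduct_mulVec u (d.D i)ᵀ, vecMul_transpose]
  have e2 : w ⬝ᵥ u = z ⬝ᵥ X i *ᵥ v := by
    rw [hw, dotProduct_comm, dotProduct_mulVec u, vecMul_transpose]
  have e3 : 0 ≤ (v - z) ⬝ᵥ X i *ᵥ (v - z) := psd_nonneg (hX i) _
  have e4 : (v - z) ⬝ᵥ X i *ᵥ (v - z)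
      = v ⬝ᵥ X i *ᵥ v - 2 * (z ⬝ᵥ X i *ᵥ v) + z ⬝ᵥ X i *ᵥ z := by
    rw [mulVec_sub, dotProduct_sub, sub_dotProduct, sub_dotProduct, symm_dot hsym v z]; ring
  have e5 : 0 ≤ u ⬝ᵥ d.N i *ᵥ u := psd_nonneg (hd.N_pos i).posSemidef _
  have e6 : 0 ≤ x ⬝ᵥ d.Q i *ᵥ x := psd_nonneg (hd.Q_pos i) _
  have e7 : 0 ≤ x ⬝ᵥ (∑ j, d.lam i j • (X j - X i)) *ᵥ x := by
    rw [sum_mulVec, dotProduct_sum]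
    refine Finset.sum_nonneg fun j _ => ?_
    rw [smul_mulVec, dotProduct_smul, sub_mulVec, dotProduct_sub, hx, sub_zero, smul_eq_mul]
    by_cases hij : i = j
    · subst hij; simp [hx]
    · exact mul_nonneg (hd.lam_nonneg i j hij) (psd_nonneg (hX j) _)
  have e8 : x ⬝ᵥ ((d.S X i)ᵀ * (d.Nt X i)⁻¹ * d.S X i) *ᵥ x = w ⬝ᵥ u := by
    rw [← mulVec_mulVec, ← mulVec_mulVec, hS, ← hu, dotProduct_mulVec x, vecMul_transpose, hS]
  have e9 : x ⬝ᵥ (X i * d.A i) *ᵥ x = 0 := by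
    rw [← mulVec_mulVec, symm_dot hsym, hk, dotProduct_zero]
  have e10 : x ⬝ᵥ ((d.A i)ᵀ * X i) *ᵥ x = 0 := by
    rw [← mulVec_mulVec, hk, mulVec_zero, dotProduct_zero]
  have e11 : x ⬝ᵥ ((d.C i)ᵀ * X i * d.C i) *ᵥ x = v ⬝ᵥ X i *ᵥ v := by
    rw [← mulVec_mulVec, ← mulVec_mulVec, dotProduct_mulVec x, vecMul_transpose]
  have : x ⬝ᵥ d.F X i *ᵥ x = v ⬝ᵥ X i *ᵥ v + x ⬝ᵥ d.Q i *ᵥ x - w ⬝ᵥ u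
      + x ⬝ᵥ (∑ j, d.lam i j • (X j - X i)) *ᵥ x := by
    rw [F, add_mulVec, sub_mulVec, add_mulVec, add_mulVec, add_mulVec, dotProduct_add,
      dotProduct_sub, dotProduct_add, dotProduct_add, dotProduct_add, e8, e9, e10, e11]
    ring
  rw [this]
  linarith

lemma psd_entry {k : ℕ} {Y : Matrix (Fin k) (Fin k) ℝ} (h : Y.PosSemidef) (a b : Fin k) :
    |Y a b| ≤ Y.trace := by
  have hs : Y b a = Y a b := by
    conv_rhs => rw [← psd_symm h]
    rfl
  have hdiag : ∀ c, Y c c ≤ Y.trace := fun c =>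
    Finset.single_le_sum (f := fun c => Y c c) (fun j _ => h.diag_nonneg) (Finset.mem_univ c)
  have h1 := psd_nonneg h (Pi.single a 1 + Pi.single b 1)
  have h2 := psd_nonneg h (Pi.single a 1 - Pi.single b 1)
  simp only [mulVec_add, mulVec_sub, dotProduct_add, dotProduct_sub, add_dotProduct,
    sub_dotProduct, mulVec_single_one, single_one_dotProduct, col_apply] at h1 h2
  have := hdiag a
  have := hdiag b
  rw [abs_le]
  constructor <;> linarith

end Algebra
end RicData
namespace RicData
section Analysis

open Set Filter Topology

set_option linter.unusedSectionVars false

attribute [local instance] Matrix.normedAddCommGroup Matrix.normedSpace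

variable {n m : ℕ} {M : Type*} [Fintype M] {d : RicData n m M}

/-- Total trace. -/
def tau : (M → Matrix (Fin n) (Fin n) ℝ) →ₗ[ℝ] ℝ where
  toFun X := ∑ i, (X i).trace
  map_add' X Y := by simp [trace_add, Finset.sum_add_distrib]
  map_smul' c X := by simp [trace_smul, Finset.mul_sum]

/-- The quadratic form of the component `i` at `x`. -/
def qf (i : M) (x : Fin n → ℝ) : (M → Matrix (Fin n) (Fin n) ℝ) →ₗ[ℝ] ℝ where
  toFun X := x ⬝ᵥ X i *ᵥ x
  map_add' X Y := by simp [add_mulVec, dotProduct_add]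
  map_smul' c X := by simp [smul_mulVec, dotProduct_smul]

/-- Linear part of the trace of the vector field. -/
def linF (d : RicData n m M) : (M → Matrix (Fin n) (Fin n) ℝ) →ₗ[ℝ] ℝ where
  toFun X := ∑ i, (X i * d.A i + (d.A i)ᵀ * X i + (d.C i)ᵀ * X i * d.C i
    + ∑ j, d.lam i j • (X j - X i)).trace
  map_add' X Y := by
    rw [← Finset.sum_add_distrib]
    refine Finset.sum_congr rfl fun i _ => ?_
    rw [← trace_add]
    congr 1
    have : ∑ j, d.lam i j • ((X + Y) j - (X + Y) i)
        = ∑ j, d.lam i j • (X j - X i) + ∑ j, d.lam i j • (Y j - Y i) := by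
      rw [← Finset.sum_add_distrib]
      refine Finset.sum_congr rfl fun j _ => ?_
      rw [← smul_add]; congr 1; simp only [Pi.add_apply]; abel
    rw [this]
    simp only [Pi.add_apply, Matrix.add_mul, Matrix.mul_add]
    abel
  map_smul' c X := by
    rw [RingHom.id_apply, smul_eq_mul, Finset.mul_sum]
    refine Finset.sum_congr rfl fun i _ => ?_
    refine Eq.trans ?_ (trace_smul c _)
    congr 1
    simp only [Pi.smul_apply, smul_add, Finset.smul_sum, Matrix.smul_mul, Matrix.mul_smul,
      smul_sub, smul_comm c]

lemma hasDeriv_lin (l : (M → Matrix (Fin n) (Fin n) ℝ) →ₗ[ℝ] ℝ)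
    {X : ℝ → M → Matrix (Fin n) (Fin n) ℝ} {v : M → Matrix (Fin n) (Fin n) ℝ} {s : Set ℝ} {t : ℝ}
    (h : HasDerivWithinAt X v s t) : HasDerivWithinAt (fun r => l (X r)) (l v) s t :=
  (LinearMap.toContinuousLinearMap l).hasFDerivAt.comp_hasDerivWithinAt t h

lemma cont_lin (l : (M → Matrix (Fin n) (Fin n) ℝ) →ₗ[ℝ] ℝ) : Continuous l :=
  (LinearMap.toContinuousLinearMap l).continuous

lemma entry_le_norm (X : M → Matrix (Fin n) (Fin n) ℝ) (i : M) (k l : Fin n) :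
    |X i k l| ≤ ‖X‖ :=
  (Matrix.norm_entry_le_entrywise_sup_norm (X i)).trans (norm_le_pi_norm X i)

lemma tau_nonneg {X : M → Matrix (Fin n) (Fin n) ℝ} (hX : ∀ i, (X i).PosSemidef) :
    0 ≤ tau X := Finset.sum_nonneg fun i _ => (hX i).trace_nonneg

lemma norm_le_tau {X : M → Matrix (Fin n) (Fin n) ℝ} (hX : ∀ i, (X i).PosSemidef) :
    ‖X‖ ≤ tau X := by
  refine (pi_norm_le_iff_of_nonneg (tau_nonneg hX)).2 fun i => ?_
  refine (Matrix.norm_le_iff (tau_nonneg hX)).2 fun k l => ?_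
  refine (psd_entry (hX i) k l).trans ?_
  exact Finset.single_le_sum (f := fun i => (X i).trace) (fun j _ => (hX j).trace_nonneg)
    (Finset.mem_univ i)

lemma lin_bound {E : Type*} [NormedAddCommGroup E] [NormedSpace ℝ E] [FiniteDimensional ℝ E]
    (l : E →ₗ[ℝ] ℝ) : ∃ c : ℝ, 0 ≤ c ∧ ∀ x, l x ≤ c * ‖x‖ :=
  ⟨‖LinearMap.toContinuousLinearMap l‖, norm_nonneg _, fun x =>
    (le_abs_self _).trans ((LinearMap.toContinuousLinearMap l).le_opNorm x)⟩

lemma F_trace (hd : d.Good) : ∃ c : ℝ, 0 ≤ c ∧ ∀ X : M → Matrix (Fin n) (Fin n) ℝ,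
    (∀ i, (X i).PosSemidef) → tau (d.F X) ≤ c * (tau X + 1) := by
  obtain ⟨c, hc, hl⟩ := lin_bound (linF d)
  have hq : 0 ≤ tau d.Q := tau_nonneg hd.Q_pos
  refine ⟨c + tau d.Q, add_nonneg hc hq, fun X hX => ?_⟩
  have h1 : linF d X ≤ c * tau X :=
    (hl X).trans (mul_le_mul_of_nonneg_left (norm_le_tau hX) hc)
  have h2 : tau (d.F X) = linF d X + tau d.Q
      - ∑ i, ((d.S X i)ᵀ * (d.Nt X i)⁻¹ * d.S X i).trace := by
    show ∑ i, (d.F X i).trace = ∑ i, (X i * d.A i + (d.A i)ᵀ * X i + (d.C i)ᵀ * X i * d.C i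
      + ∑ j, d.lam i j • (X j - X i)).trace + ∑ i, (d.Q i).trace - _
    rw [← Finset.sum_add_distrib, ← Finset.sum_sub_distrib]
    refine Finset.sum_congr rfl fun i _ => ?_
    rw [← trace_add, ← trace_sub, F]
    congr 1
    abel
  have h3 : 0 ≤ ∑ i, ((d.S X i)ᵀ * (d.Nt X i)⁻¹ * d.S X i).trace :=
    Finset.sum_nonneg fun i _ =>
      (psd_conj (Nt_posDef hd hX i).posSemidef.inv (d.S X i)).trace_nonneg
  have h4 := tau_nonneg hX
  nlinarith [mul_nonneg hq h4]

/-- Smoothness of a matrix valued map, entrywise. -/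
def CD {k l : ℕ} (f : (M → Matrix (Fin n) (Fin n) ℝ) → Matrix (Fin k) (Fin l) ℝ)
    (X : M → Matrix (Fin n) (Fin n) ℝ) : Prop :=
  ∀ a b, ContDiffAt ℝ 1 (fun Y => f Y a b) X

variable {X : M → Matrix (Fin n) (Fin n) ℝ}

lemma CD.const {k l : ℕ} (B : Matrix (Fin k) (Fin l) ℝ) : CD (fun _ => B) X :=
  fun _ _ => contDiffAt_const

lemma CD.proj (i : M) : CD (fun Y => Y i) X := by
  intro a b
  let l : (M → Matrix (Fin n) (Fin n) ℝ) →ₗ[ℝ] ℝ :=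
    { toFun := fun Y => Y i a b, map_add' := fun _ _ => rfl, map_smul' := fun _ _ => rfl }
  exact (LinearMap.toContinuousLinearMap l).contDiff.contDiffAt

lemma CD.mul {k l p : ℕ} {f : (M → Matrix (Fin n) (Fin n) ℝ) → Matrix (Fin k) (Fin l) ℝ}
    {g : (M → Matrix (Fin n) (Fin n) ℝ) → Matrix (Fin l) (Fin p) ℝ} (hf : CD f X) (hg : CD g X) :
    CD (fun Y => f Y * g Y) X := by
  intro a b
  simp only [mul_apply]
  exact ContDiffAt.sum fun j _ => (hf a j).mul (hg j b)

lemma CD.add {k l : ℕ} {f g : (M → Matrix (Fin n) (Fin n) ℝ) → Matrix (Fin k) (Fin l) ℝ}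
    (hf : CD f X) (hg : CD g X) : CD (fun Y => f Y + g Y) X :=
  fun a b => (hf a b).add (hg a b)

lemma CD.sub {k l : ℕ} {f g : (M → Matrix (Fin n) (Fin n) ℝ) → Matrix (Fin k) (Fin l) ℝ}
    (hf : CD f X) (hg : CD g X) : CD (fun Y => f Y - g Y) X :=
  fun a b => (hf a b).sub (hg a b)

lemma CD.smul {k l : ℕ} {f : (M → Matrix (Fin n) (Fin n) ℝ) → Matrix (Fin k) (Fin l) ℝ}
    (c : ℝ) (hf : CD f X) : CD (fun Y => c • f Y) X :=
  fun a b => contDiffAt_const.mul (hf a b)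

lemma CD.transpose {k l : ℕ} {f : (M → Matrix (Fin n) (Fin n) ℝ) → Matrix (Fin k) (Fin l) ℝ}
    (hf : CD f X) : CD (fun Y => (f Y)ᵀ) X :=
  fun a b => hf b a

lemma CD.sum {k l : ℕ} {f : M → (M → Matrix (Fin n) (Fin n) ℝ) → Matrix (Fin k) (Fin l) ℝ}
    (hf : ∀ j, CD (f j) X) : CD (fun Y => ∑ j, f j Y) X := by
  intro a b
  simp only [Matrix.sum_apply]
  exact ContDiffAt.sum fun j _ => hf j a b

lemma CD.det {k : ℕ} {f : (M → Matrix (Fin n) (Fin n) ℝ) → Matrix (Fin k) (Fin k) ℝ}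
    (hf : CD f X) : ContDiffAt ℝ 1 (fun Y => (f Y).det) X := by
  simp only [det_apply']
  exact ContDiffAt.sum fun j _ => contDiffAt_const.mul (contDiffAt_prod fun _ _ => hf _ _)

lemma CD.inv {k : ℕ} {f : (M → Matrix (Fin n) (Fin n) ℝ) → Matrix (Fin k) (Fin k) ℝ}
    (hf : CD f X) (h : (f X).det ≠ 0) : CD (fun Y => (f Y)⁻¹) X := by
  intro a b
  simp only [inv_def, Ring.inverse_eq_inv', Matrix.smul_apply, smul_eq_mul, adjugate_apply]
  refine (hf.det.inv h).mul (CD.det fun c e => ?_)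
  by_cases hc : c = b
  · subst hc; simp only [updateRow_self]; exact contDiffAt_const
  · simp only [updateRow_ne hc]; exact hf c e

lemma CD.Nt (d : RicData n m M) (i : M) : CD (fun Y => d.Nt Y i) X :=
  (CD.const _).add (((CD.const _).mul (CD.proj i)).mul (CD.const _))

lemma CD.S (d : RicData n m M) (i : M) : CD (fun Y => d.S Y i) X :=
  ((CD.const _).mul (CD.proj i)).add (((CD.const _).mul (CD.proj i)).mul (CD.const _))

lemma CD.F (i : M) (h : (d.Nt X i).det ≠ 0) : CD (fun Y => d.F Y i) X :=
  (((((CD.proj i).mul (CD.const _)).add ((CD.const _).mul (CD.proj i))).add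
    (((CD.const _).mul (CD.proj i)).mul (CD.const _))).add (CD.const _)).sub
    (((CD.S d i).transpose.mul ((CD.Nt d i).inv h)).mul (CD.S d i)) |>.add
    (CD.sum fun j => ((CD.proj j).sub (CD.proj i)).smul _)

lemma F_contDiffAt (h : ∀ i, (d.Nt X i).det ≠ 0) : ContDiffAt ℝ 1 d.F X :=
  contDiffAt_pi.2 fun i => contDiffAt_pi.2 fun k => contDiffAt_pi.2 fun l => CD.F i (h i) k l

lemma isOpen_U (d : RicData n m M) :
    IsOpen {X : M → Matrix (Fin n) (Fin n) ℝ | ∀ i, (d.Nt X i).det ≠ 0} := by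
  have hc : ∀ i, Continuous fun X : M → Matrix (Fin n) (Fin n) ℝ => (d.Nt X i).det := fun i =>
    continuous_iff_continuousAt.2 fun X => (CD.Nt (X := X) d i).det.continuousAt
  simp only [ofPred_forall]
  exact isOpen_iInter_of_finite fun i => isOpen_ne_fun (hc i) continuous_const

/-- The compact piece of the cone. -/
def KR (n : ℕ) (M : Type*) [Fintype M] (R : ℝ) : Set (M → Matrix (Fin n) (Fin n) ℝ) :=
  {X | (∀ i, (X i).PosSemidef) ∧ tau X ≤ R}

lemma isCompact_KR (R : ℝ) : IsCompact (KR n M R) := by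
  refine Metric.isCompact_of_isClosed_isBounded ?_ ?_
  · have : KR n M R = (⋂ i, ({X | (X i)ᵀ = X i} ∩ ⋂ x, {X | 0 ≤ qf i x X})) ∩ {X | tau X ≤ R} := by
      ext X
      simp only [KR, mem_inter_iff, mem_iInter, mem_ofPred_eq]
      refine and_congr_left fun _ => forall_congr' fun i => ?_
      exact ⟨fun h => ⟨psd_symm h, psd_nonneg h⟩, fun h => psd_of h.1 h.2⟩
    rw [this]
    refine IsClosed.inter (isClosed_iInter fun i => IsClosed.inter ?_ ?_) ?_
    · exact isClosed_eq (continuous_apply i).matrix_transpose (continuous_apply i)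
    · exact isClosed_iInter fun x => isClosed_le continuous_const (cont_lin _)
    · exact isClosed_le (cont_lin _) continuous_const
  · exact isBounded_iff_forall_norm_le.2 ⟨R, fun X hX => (norm_le_tau hX.1).trans hX.2⟩

open scoped Manifold ContDiff in
lemma exists_cutoff_general {E : Type*} [NormedAddCommGroup E] [NormedSpace ℝ E]
    [FiniteDimensional ℝ E] {K U : Set E} (hK : IsCompact K) (hUo : IsOpen U) (hU : K ⊆ U)
    (F : E → E) (hF : ∀ X ∈ U, ContDiffAt ℝ 1 F X) :
    ∃ χ : E → ℝ, (∀ X, χ X ∈ Icc (0:ℝ) 1) ∧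
      (∀ X ∈ K, χ X = 1) ∧ (∃ K, LipschitzWith K fun X => χ X • F X) ∧
      ∃ L, ∀ X, ‖χ X • F X‖ ≤ L := by
  have : ProperSpace E := FiniteDimensional.proper ℝ E
  obtain ⟨K', hK', h1, h2⟩ := exists_compact_between hK hUo hU
  obtain ⟨f, hf1, hf2, hf3⟩ := exists_contMDiffMap_one_nhds_of_subset_interior (n := 1)
    𝓘(ℝ, E) hK.isClosed h1
  have hts : tsupport f ⊆ K' := closure_minimal
    (fun x hx => by by_contra h; exact hx (hf2 x h)) hK'.isClosed
  have hfc : ContDiff ℝ 1 f := f.contMDiff.contDiff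
  have hs : HasCompactSupport (fun X => f X • F X) :=
    hK'.of_isClosed_subset isClosed_closure ((tsupport_smul_subset_left _ _).trans hts)
  have hcd : ContDiff ℝ 1 (fun X => f X • F X) := by
    refine contDiff_iff_contDiffAt.2 fun X => ?_
    by_cases hX : X ∈ tsupport f
    · exact hfc.contDiffAt.smul (hF X (h2 (hts hX)))
    · have : (fun X => f X • F X) =ᶠ[𝓝 X] fun _ => 0 := by
        filter_upwards [notMem_tsupport_iff_eventuallyEq.1 hX] with Y hY
        rw [hY]; simp
      exact contDiffAt_const.congr_of_eventuallyEq this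
  refine ⟨f, hf3, fun X hX => hf1.self_of_nhdsSet X hX,
    hcd.lipschitzWith_of_hasCompactSupport hs (by norm_num), ?_⟩
  exact hs.exists_bound_of_continuous hcd.continuous

lemma exists_cutoff (hd : d.Good) (R : ℝ) :
    ∃ χ : (M → Matrix (Fin n) (Fin n) ℝ) → ℝ, (∀ X, χ X ∈ Icc (0:ℝ) 1) ∧
      (∀ X ∈ KR n M R, χ X = 1) ∧ (∃ K, LipschitzWith K fun X => χ X • d.F X) ∧
      ∃ L, ∀ X, ‖χ X • d.F X‖ ≤ L :=
  exists_cutoff_general (isCompact_KR R) (isOpen_U d)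
    (fun _ hX i => (Nt_posDef hd hX.1 i).det_pos.ne') d.F fun _ hX => F_contDiffAt hX

end Analysis
end RicData
namespace RicData
section Dynamics

open Set Filter Topology

set_option linter.unusedSectionVars false

attribute [local instance] Matrix.normedAddCommGroup Matrix.normedSpace

variable {n m : ℕ} {M : Type*} [Fintype M] {d : RicData n m M}

lemma unit_entry {x : Fin n → ℝ} (hx : x ⬝ᵥ x = 1) (k : Fin n) : |x k| ≤ 1 := by
  have : x k * x k ≤ x ⬝ᵥ x :=
    Finset.single_le_sum (f := fun k => x k * x k) (fun j _ => mul_self_nonneg _)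
      (Finset.mem_univ k)
  rw [hx] at this
  exact abs_le_one_iff_mul_self_le_one.2 this

lemma qf_bound (i : M) {x : Fin n → ℝ} (hx : x ⬝ᵥ x = 1) (Z : M → Matrix (Fin n) (Fin n) ℝ) :
    |qf i x Z| ≤ (n : ℝ) ^ 2 * ‖Z‖ := by
  have h0 : qf i x Z = ∑ k, ∑ l, x k * (Z i k l * x l) := by
    simp [qf, dotProduct, mulVec, Finset.mul_sum]
  rw [h0]
  have : ∀ k l, |x k * (Z i k l * x l)| ≤ ‖Z‖ := fun k l => by
    rw [abs_mul, abs_mul]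
    have h1 := unit_entry hx k
    have h2 := unit_entry hx l
    have h3 := entry_le_norm Z i k l
    calc |x k| * (|Z i k l| * |x l|) ≤ 1 * (‖Z‖ * 1) := by gcongr
      _ = ‖Z‖ := by ring
  calc |∑ k, ∑ l, x k * (Z i k l * x l)| ≤ ∑ k : Fin n, ∑ l : Fin n, ‖Z‖ :=
        (Finset.abs_sum_le_sum_abs _ _).trans (Finset.sum_le_sum fun k _ =>
          (Finset.abs_sum_le_sum_abs _ _).trans (Finset.sum_le_sum fun l _ => this k l))
    _ = (n : ℝ) ^ 2 * ‖Z‖ := by simp; ring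

lemma psd_of_unit {Y : Matrix (Fin n) (Fin n) ℝ} (h : Yᵀ = Y)
    (h2 : ∀ x : Fin n → ℝ, x ⬝ᵥ x = 1 → 0 ≤ x ⬝ᵥ Y *ᵥ x) : Y.PosSemidef := by
  refine psd_of h fun x => ?_
  by_cases hx : x ⬝ᵥ x = 0
  · rw [dotProduct_self_eq_zero] at hx
    simp [hx]
  · have hpos : 0 < x ⬝ᵥ x :=
      lt_of_le_of_ne (Finset.sum_nonneg fun k _ => mul_self_nonneg _) (Ne.symm hx)
    have hs : √(x ⬝ᵥ x) * √(x ⬝ᵥ x) = x ⬝ᵥ x := Real.mul_self_sqrt hpos.le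
    have hs0 : 0 < √(x ⬝ᵥ x) := Real.sqrt_pos.2 hpos
    have := h2 ((√(x ⬝ᵥ x))⁻¹ • x) (by
      rw [smul_dotProduct, dotProduct_smul, smul_eq_mul, smul_eq_mul]
      nth_rw 3 [← hs]
      field_simp)
    rw [mulVec_smul, smul_dotProduct, dotProduct_smul, smul_eq_mul, smul_eq_mul] at this
    have hi : 0 < (√(x ⬝ᵥ x))⁻¹ := inv_pos.2 hs0
    exact nonneg_of_mul_nonneg_right (nonneg_of_mul_nonneg_right this hi) hi

lemma one_symm_psd : ∀ i : M, ((1 : M → Matrix (Fin n) (Fin n) ℝ) i).PosSemidef :=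
  fun _ => PosSemidef.one

lemma norm_one_le : ‖(1 : M → Matrix (Fin n) (Fin n) ℝ)‖ ≤ 1 := by
  refine (pi_norm_le_iff_of_nonneg zero_le_one).2 fun i => ?_
  refine (Matrix.norm_le_iff zero_le_one).2 fun k l => ?_
  rw [Pi.one_apply, Matrix.one_apply]
  split_ifs <;> simp

lemma qf_one (i : M) {x : Fin n → ℝ} (hx : x ⬝ᵥ x = 1) : qf i x 1 = 1 := by
  simp [qf, hx]

lemma bad_compact {T : ℝ} {X : ℝ → M → Matrix (Fin n) (Fin n) ℝ}
    (hcont : ContinuousOn X (Icc 0 T)) (ε L : ℝ) (i : M) :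
    IsCompact {t | t ∈ Icc (0:ℝ) T ∧ ∃ x : Fin n → ℝ, x ⬝ᵥ x = 1 ∧
        qf i x (X t) + ε * Real.exp (L * t) ≤ 0} := by
  have hsph : IsCompact {x : Fin n → ℝ | x ⬝ᵥ x = 1} := by
    refine Metric.isCompact_of_isClosed_isBounded
      (isClosed_eq (continuous_id.dotProduct continuous_id) continuous_const) ?_
    refine isBounded_iff_forall_norm_le.2 ⟨1, fun x hx => ?_⟩
    exact (pi_norm_le_iff_of_nonneg zero_le_one).2 fun k => unit_entry hx k
  have hcomp : IsCompact ((Icc (0:ℝ) T) ×ˢ {x : Fin n → ℝ | x ⬝ᵥ x = 1}) :=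
    isCompact_Icc.prod hsph
  have hqc : ContinuousOn (fun p : ℝ × (Fin n → ℝ) =>
      qf i p.2 (X p.1) + ε * Real.exp (L * p.1))
      ((Icc (0:ℝ) T) ×ˢ {x : Fin n → ℝ | x ⬝ᵥ x = 1}) := by
    have hent : ∀ k l, ContinuousOn (fun p : ℝ × (Fin n → ℝ) => X p.1 i k l)
        ((Icc (0:ℝ) T) ×ˢ {x : Fin n → ℝ | x ⬝ᵥ x = 1}) := by
      intro k l
      have h1 : ContinuousOn (fun p : ℝ × (Fin n → ℝ) => X p.1)
          ((Icc (0:ℝ) T) ×ˢ {x : Fin n → ℝ | x ⬝ᵥ x = 1}) :=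
        hcont.comp continuousOn_fst fun p hp => hp.1
      have h2 : Continuous fun Z : M → Matrix (Fin n) (Fin n) ℝ => Z i k l :=
        (continuous_apply i).matrix_elem k l
      exact h2.comp_continuousOn h1
    have h0 : ∀ p : ℝ × (Fin n → ℝ),
        qf i p.2 (X p.1) = ∑ k, ∑ l, p.2 k * (X p.1 i k l * p.2 l) := fun p => by
      simp [qf, dotProduct, mulVec, Finset.mul_sum]
    have hcoord : ∀ k, ContinuousOn (fun p : ℝ × (Fin n → ℝ) => p.2 k)
        ((Icc (0:ℝ) T) ×ˢ {x : Fin n → ℝ | x ⬝ᵥ x = 1}) := fun k =>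
      ((continuous_apply k).comp continuous_snd).continuousOn
    have hexp : Continuous (fun p : ℝ × (Fin n → ℝ) => ε * Real.exp (L * p.1)) :=
      continuous_const.mul (Real.continuous_exp.comp (continuous_const.mul continuous_fst))
    refine ContinuousOn.add ?_ hexp.continuousOn
    refine ContinuousOn.congr ?_ fun p _ => h0 p
    exact continuousOn_finsetSum _ fun k _ => continuousOn_finsetSum _ fun l _ =>
      (hcoord k).mul ((hent k l).mul (hcoord l))
  have := (hcomp.of_isClosed_subset (hqc.preimage_isClosed_of_isClosed hcomp.isClosed
    (isClosed_Iic (a := (0:ℝ)))) inter_subset_left).image continuous_fst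
  convert this using 1
  ext t
  constructor
  · rintro ⟨ht, x, hx, hxx⟩
    exact ⟨(t, x), ⟨⟨ht, hx⟩, hxx⟩, rfl⟩
  · rintro ⟨⟨t', x⟩, ⟨⟨ht, hx⟩, hxx⟩, rfl⟩
    exact ⟨ht, x, hx, hxx⟩

lemma invariance {V : (M → Matrix (Fin n) (Fin n) ℝ) → M → Matrix (Fin n) (Fin n) ℝ} {K : NNReal}
    (hV : LipschitzWith K V)
    (hq : ∀ Y : M → Matrix (Fin n) (Fin n) ℝ, (∀ i, (Y i).PosSemidef) → ∀ i x,
      qf i x Y = 0 → 0 ≤ qf i x (V Y))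
    {T : ℝ} {X : ℝ → M → Matrix (Fin n) (Fin n) ℝ}
    (hX : ∀ t ∈ Icc (0:ℝ) T, HasDerivWithinAt X (V (X t)) (Icc 0 T) t)
    (hs : ∀ t ∈ Icc (0:ℝ) T, ∀ i, (X t i)ᵀ = X t i)
    (h0 : ∀ i, (X 0 i).PosSemidef) :
    ∀ t ∈ Icc (0:ℝ) T, ∀ i, (X t i).PosSemidef := by
  set L : ℝ := (n : ℝ) ^ 2 * K + 1 with hL
  -- perturbed form is positive
  have key : ∀ ε : ℝ, 0 < ε → ∀ t ∈ Icc (0:ℝ) T, ∀ i, ∀ x : Fin n → ℝ, x ⬝ᵥ x = 1 →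
      0 < qf i x (X t) + ε * Real.exp (L * t) := by
    intro ε hε
    by_contra hcon
    push Not at hcon
    obtain ⟨t1, ht1, i1, x1, hx1, hle1⟩ := hcon
    have hcont : ContinuousOn X (Icc 0 T) := fun t ht => (hX t ht).continuousWithinAt
    -- compactness of the bad set
    have hbadi := bad_compact hcont ε L
    have hbad := isCompact_iUnion hbadi
    obtain ⟨t0, ht0, hmin⟩ := hbad.exists_isLeast ⟨t1, mem_iUnion.2 ⟨i1, ht1, x1, hx1, hle1⟩⟩
    obtain ⟨i, ht0T, x, hx, hle⟩ := mem_iUnion.1 ht0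
    have hbefore : ∀ t ∈ Icc (0:ℝ) T, t < t0 → ∀ j (y : Fin n → ℝ), y ⬝ᵥ y = 1 →
        0 < qf j y (X t) + ε * Real.exp (L * t) := by
      intro t ht htt j y hy
      by_contra hn
      exact absurd (hmin (mem_iUnion.2 ⟨j, ht, y, hy, not_lt.1 hn⟩)) (not_le.2 htt)
    have ht0pos : 0 < t0 := by
      rcases ht0T.1.eq_or_lt with h | h
      · exfalso
        rw [← h] at hle
        have h1 : 0 ≤ qf i x (X 0) := psd_nonneg (h0 i) x
        have h2 : 0 < ε * Real.exp (L * 0) := by positivity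
        linarith
      · exact h
    have hmem : Icc (0:ℝ) T ∈ 𝓝[<] t0 := Icc_mem_nhdsLT_of_mem ⟨ht0pos, ht0T.2⟩
    -- derivative of the perturbed form
    have hder : ∀ j (y : Fin n → ℝ), HasDerivWithinAt
        (fun t => qf j y (X t) + ε * Real.exp (L * t))
        (qf j y (V (X t0)) + ε * (Real.exp (L * t0) * L)) (Iio t0) t0 := by
      intro j y
      refine HasDerivWithinAt.add ?_ ?_
      · exact hasDeriv_lin (qf j y) ((hX t0 ht0T).mono_of_mem_nhdsWithin hmem)
      · have h1 : HasDerivAt (fun t : ℝ => L * t) L t0 := by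
          simpa using (hasDerivAt_id t0).const_mul L
        exact (h1.exp.const_mul ε).hasDerivWithinAt
    set e : ℝ := ε * Real.exp (L * t0) with he
    have hepos : 0 < e := by positivity
    set Y : M → Matrix (Fin n) (Fin n) ℝ := X t0 + e • 1 with hY
    have hqY : ∀ j (y : Fin n → ℝ), y ⬝ᵥ y = 1 → qf j y Y = qf j y (X t0) + e := by
      intro j y hy
      rw [hY, map_add, map_smul, qf_one j hy, smul_eq_mul, mul_one]
    have hYnn : ∀ j (y : Fin n → ℝ), y ⬝ᵥ y = 1 → 0 ≤ qf j y Y := by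
      intro j y hy
      rw [hqY j y hy]
      refine ge_of_tendsto (hder j y).continuousWithinAt ?_
      filter_upwards [hmem, self_mem_nhdsWithin] with t ht htt
      exact (hbefore t ht htt j y hy).le
    have hYpsd : ∀ j, (Y j).PosSemidef := by
      intro j
      refine psd_of_unit ?_ (hYnn j)
      simp [hY, hs t0 ht0T j]
    have hzero : qf i x Y = 0 := le_antisymm (by rw [hqY i x hx]; exact hle) (hYnn i x hx)
    have h1 : 0 ≤ qf i x (V Y) := hq Y hYpsd i x hzero
    have h2 : qf i x (V Y) - qf i x (V (X t0)) ≤ (n : ℝ) ^ 2 * (K * e) := by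
      rw [← map_sub]
      refine (le_abs_self _).trans ((qf_bound i hx _).trans ?_)
      refine mul_le_mul_of_nonneg_left ?_ (by positivity)
      refine (hV.norm_sub_le Y (X t0)).trans ?_
      refine mul_le_mul_of_nonneg_left ?_ K.2
      rw [hY, add_sub_cancel_left, norm_smul, Real.norm_of_nonneg hepos.le]
      exact mul_le_of_le_one_right hepos.le norm_one_le
    have h3 : qf i x (V (X t0)) + ε * (Real.exp (L * t0) * L) ≤ 0 := by
      have ht := (hasDerivWithinAt_iff_tendsto_slope' (by simp)).1 (hder i x)
      refine le_of_tendsto ht ?_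
      filter_upwards [hmem, self_mem_nhdsWithin] with t ht htt
      have hp := hbefore t ht htt i x hx
      rw [slope_def_field]
      exact div_nonpos_of_nonneg_of_nonpos (by linarith) (sub_nonpos.2 (le_of_lt htt))
    have h4 : ε * (Real.exp (L * t0) * L) = (n : ℝ) ^ 2 * (K * e) + e := by
      rw [he, hL]; ring
    linarith
  intro t ht i
  refine psd_of_unit (hs t ht i) fun x hx => ?_
  refine le_of_forall_pos_lt_add fun δ hδ => ?_
  have := key (δ / Real.exp (L * t)) (by positivity) t ht i x hx
  rwa [div_mul_cancel₀ _ (Real.exp_pos _).ne'] at this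

lemma apriori {c : ℝ} (hc : 0 ≤ c) (hF : ∀ X : M → Matrix (Fin n) (Fin n) ℝ,
    (∀ i, (X i).PosSemidef) → tau (d.F X) ≤ c * (tau X + 1))
    {T : ℝ} {X : ℝ → M → Matrix (Fin n) (Fin n) ℝ} {θ : ℝ → ℝ}
    (hθ : ∀ t, θ t ∈ Icc (0:ℝ) 1)
    (hX : ∀ t ∈ Icc (0:ℝ) T, HasDerivWithinAt X (θ t • d.F (X t)) (Icc 0 T) t)
    (hp : ∀ t ∈ Icc (0:ℝ) T, ∀ i, (X t i).PosSemidef) :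
    ∀ t ∈ Icc (0:ℝ) T, tau (X t) ≤ (tau (X 0) + 1) * Real.exp (c * T) := by
  intro t ht
  have hder : ∀ s ∈ Icc (0:ℝ) T, HasDerivWithinAt
      (fun s => Real.exp (-c * s) * (tau (X s) + 1))
      (Real.exp (-c * s) * -c * (tau (X s) + 1) + Real.exp (-c * s) * tau (θ s • d.F (X s)))
      (Icc 0 T) s := by
    intro s hs
    have h1 : HasDerivAt (fun t : ℝ => -c * t) (-c) s := by
      simpa using (hasDerivAt_id s).const_mul (-c)
    exact (h1.exp.hasDerivWithinAt).mul ((hasDeriv_lin tau (hX s hs)).add_const 1)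
  have hanti : AntitoneOn (fun s => Real.exp (-c * s) * (tau (X s) + 1)) (Icc 0 T) := by
    refine antitoneOn_of_hasDerivWithinAt_nonpos (convex_Icc _ _)
      (fun s hs => (hder s hs).continuousWithinAt)
      (fun s hs => (hder s (interior_subset hs)).mono interior_subset) fun s hs => ?_
    have hs' := interior_subset hs
    rw [map_smul, smul_eq_mul]
    have h1 := hF _ (hp s hs')
    have h2 := tau_nonneg (hp s hs')
    have h3 : θ s * tau (d.F (X s)) ≤ c * (tau (X s) + 1) :=
      (mul_le_mul_of_nonneg_left h1 (hθ s).1).trans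
        (mul_le_of_le_one_left (by positivity) (hθ s).2)
    have h4 := Real.exp_pos (-c * s)
    nlinarith
  have h0T : (0:ℝ) ≤ T := ht.1.trans ht.2
  have h := hanti ⟨le_rfl, h0T⟩ ht ht.1
  simp only [mul_zero, Real.exp_zero, one_mul] at h
  have h1 : tau (X t) + 1 ≤ (tau (X 0) + 1) * Real.exp (c * t) := by
    have h5 := mul_le_mul_of_nonneg_right h (Real.exp_pos (c * t)).le
    have h6 : Real.exp (-c * t) * Real.exp (c * t) = 1 := by rw [← Real.exp_add]; simp
    calc tau (X t) + 1 = (Real.exp (-c * t) * Real.exp (c * t)) * (tau (X t) + 1) := by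
          rw [h6, one_mul]
      _ = Real.exp (-c * t) * (tau (X t) + 1) * Real.exp (c * t) := by ring
      _ ≤ _ := h5
  have h2 : Real.exp (c * t) ≤ Real.exp (c * T) :=
    Real.exp_le_exp.2 (mul_le_mul_of_nonneg_left ht.2 hc)
  have h3 := tau_nonneg (hp 0 ⟨le_rfl, h0T⟩)
  have h7 : (tau (X 0) + 1) * Real.exp (c * t) ≤ (tau (X 0) + 1) * Real.exp (c * T) :=
    mul_le_mul_of_nonneg_left h2 (by linarith)
  linarith

/-- Symmetrization. -/
noncomputable def symL : (M → Matrix (Fin n) (Fin n) ℝ) →ₗ[ℝ] (M → Matrix (Fin n) (Fin n) ℝ) where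
  toFun X := fun i => (1/2 : ℝ) • (X i + (X i)ᵀ)
  map_add' X Y := by
    funext i
    simp only [Pi.add_apply, transpose_add, ← smul_add]
    congr 1; abel
  map_smul' c X := by
    funext i
    simp only [Pi.smul_apply, transpose_smul, RingHom.id_apply, ← smul_add]
    rw [smul_comm]

lemma lin_lip {E : Type*} [NormedAddCommGroup E] [NormedSpace ℝ E] [FiniteDimensional ℝ E]
    (l : E →ₗ[ℝ] E) : ∃ K, LipschitzWith K l :=
  ⟨_, (LinearMap.toContinuousLinearMap l).lipschitz⟩

lemma picard {E : Type*} [NormedAddCommGroup E] [NormedSpace ℝ E] [FiniteDimensional ℝ E]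
    (V : E → E) {K : NNReal} (hK : LipschitzWith K V) {L : ℝ} (hL : ∀ x, ‖V x‖ ≤ L) (x₀ : E)
    {T : ℝ} (hT : 0 ≤ T) : ∃ X : ℝ → E, X 0 = x₀ ∧
      ∀ t ∈ Icc (0:ℝ) T, HasDerivWithinAt X (V (X t)) (Icc 0 T) t := by
  have : CompleteSpace E := FiniteDimensional.complete ℝ E
  have hL0 : 0 ≤ L := (norm_nonneg _).trans (hL x₀)
  have hp : IsPicardLindelof (fun _ => V) (tmin := 0) (tmax := T) ⟨0, le_rfl, hT⟩ x₀
      (⟨L * T, mul_nonneg hL0 hT⟩ : NNReal) 0 ⟨L, hL0⟩ K :=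
    IsPicardLindelof.of_time_independent (fun x _ => hL x) hK.lipschitzOnWith (by
      simp [max_eq_left hT]; exact le_rfl)
  exact hp.exists_eq_forall_mem_Icc_hasDerivWithinAt₀

lemma forward (hd : d.Good) {G : M → Matrix (Fin n) (Fin n) ℝ} (hG : ∀ i, (G i).PosSemidef)
    {T : ℝ} (hT : 0 < T) : ∃ X : ℝ → M → Matrix (Fin n) (Fin n) ℝ,
      (X 0 = G ∧ (∀ t ∈ Icc (0:ℝ) T, ∀ i, (X t i).PosSemidef) ∧
        ∀ t ∈ Icc (0:ℝ) T, HasDerivWithinAt X (d.F (X t)) (Icc 0 T) t) ∧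
      ∀ X' : ℝ → M → Matrix (Fin n) (Fin n) ℝ,
        (X' 0 = G ∧ (∀ t ∈ Icc (0:ℝ) T, ∀ i, (X' t i).PosSemidef) ∧
        ∀ t ∈ Icc (0:ℝ) T, HasDerivWithinAt X' (d.F (X' t)) (Icc 0 T) t) →
        ∀ t ∈ Icc (0:ℝ) T, X' t = X t := by
  obtain ⟨c, hc, hF⟩ := F_trace hd
  obtain ⟨χ, hχ, hχ1, ⟨K, hK⟩, ⟨L, hL⟩⟩ :=
    exists_cutoff hd (n := n) (M := M) ((tau G + 1) * Real.exp (c * T))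
  have h0T : (0:ℝ) ∈ Icc (0:ℝ) T := ⟨le_rfl, hT.le⟩
  obtain ⟨Ks, hKs⟩ := lin_lip (symL (n := n) (M := M))
  obtain ⟨X, hX0, hX⟩ := picard (fun X => χ (symL X) • d.F (symL X)) (hK.comp hKs)
    (fun X => hL (symL X)) G hT.le
  have hsymL : ∀ (Z : M → Matrix (Fin n) (Fin n) ℝ) i, (symL Z i)ᵀ = symL Z i := by
    intro Z i
    simp [symL, add_comm]
  have hsym : ∀ t ∈ Icc (0:ℝ) T, ∀ i, (X t i)ᵀ = X t i := by
    intro t ht i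
    ext k l
    let ℓ : (M → Matrix (Fin n) (Fin n) ℝ) →ₗ[ℝ] ℝ :=
      { toFun := fun Z => Z i l k - Z i k l
        map_add' := fun Z W => by simp; ring
        map_smul' := fun a Z => by simp; ring }
    have hd0 : ∀ s ∈ Icc (0:ℝ) T, HasDerivWithinAt (fun s => ℓ (X s)) 0 (Icc 0 T) s := by
      intro s hs
      have h1 := hasDeriv_lin ℓ (hX s hs)
      have h2 : ℓ (χ (symL (X s)) • d.F (symL (X s))) = 0 := by
        have h3 : d.F (symL (X s)) i l k = d.F (symL (X s)) i k l :=
          congrFun (congrFun (F_symm hd (hsymL (X s)) i) k) l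
        rw [map_smul]
        show _ • (d.F (symL (X s)) i l k - d.F (symL (X s)) i k l) = 0
        rw [h3, sub_self, smul_zero]
      rwa [h2] at h1
    have hconst := constant_of_has_deriv_right_zero
      (fun s hs => (hd0 s hs).continuousWithinAt)
      (fun s hs => (hd0 s ⟨hs.1, hs.2.le⟩).mono_of_mem_nhdsWithin
        (Icc_mem_nhdsGE_of_mem hs)) t ht
    have hz : ℓ (X 0) = 0 := by
      show X 0 i l k - X 0 i k l = 0
      have h3 : X 0 i l k = X 0 i k l := by
        rw [hX0]; exact congrFun (congrFun (psd_symm (hG i)) k) l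
      rw [h3, sub_self]
    rw [hz] at hconst
    exact sub_eq_zero.1 hconst
  have hX2 : ∀ t ∈ Icc (0:ℝ) T, HasDerivWithinAt X (χ (X t) • d.F (X t)) (Icc 0 T) t := by
    intro t ht
    have h1 : symL (X t) = X t := by
      funext i
      show (1/2 : ℝ) • (X t i + (X t i)ᵀ) = X t i
      rw [hsym t ht i, ← two_smul ℝ (X t i), smul_smul]; norm_num
    have h2 := hX t ht
    simp only [h1] at h2
    exact h2
  have hpsd : ∀ t ∈ Icc (0:ℝ) T, ∀ i, (X t i).PosSemidef := by
    refine invariance hK ?_ hX2 hsym (by rw [hX0]; exact hG)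
    intro Y hY i x hx
    rw [map_smul, smul_eq_mul]
    exact mul_nonneg (hχ Y).1 (F_quasi hd hY i x hx)
  have hX3 : ∀ t ∈ Icc (0:ℝ) T, HasDerivWithinAt X (d.F (X t)) (Icc 0 T) t := by
    intro t ht
    have hb := apriori hc hF (θ := fun t => χ (X t)) (fun t => hχ _) hX2 hpsd t ht
    rw [hX0] at hb
    have h1 := hX2 t ht
    rwa [hχ1 _ ⟨hpsd t ht, hb⟩, one_smul] at h1
  refine ⟨X, ⟨hX0, hpsd, hX3⟩, fun X' ⟨h0', hp', hd'⟩ => ?_⟩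
  have hX4 : ∀ t ∈ Icc (0:ℝ) T, HasDerivWithinAt X' (χ (X' t) • d.F (X' t)) (Icc 0 T) t := by
    intro t ht
    have hb := apriori hc hF (θ := fun _ => 1) (fun t => ⟨zero_le_one, le_rfl⟩)
      (fun t ht => by simpa using hd' t ht) hp' t ht
    rw [h0'] at hb
    rw [hχ1 _ ⟨hp' t ht, hb⟩, one_smul]
    exact hd' t ht
  exact ODE_solution_unique (v := fun _ X => χ X • d.F X) (fun _ => hK)
    (fun t ht => (hX4 t ht).continuousWithinAt)
    (fun t ht => (hX4 t ⟨ht.1, ht.2.le⟩).mono_of_mem_nhdsWithin (Icc_mem_nhdsGE_of_mem ht))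
    (fun t ht => (hX2 t ht).continuousWithinAt)
    (fun t ht => (hX2 t ⟨ht.1, ht.2.le⟩).mono_of_mem_nhdsWithin (Icc_mem_nhdsGE_of_mem ht))
    (h0'.trans hX0.symm)

lemma deriv_iff {X : ℝ → M → Matrix (Fin n) (Fin n) ℝ} {v : M → Matrix (Fin n) (Fin n) ℝ}
    {s : Set ℝ} {t : ℝ} : HasDerivWithinAt X v s t ↔
      ∀ i k l, HasDerivWithinAt (fun r => X r i k l) (v i k l) s t := by
  refine hasDerivWithinAt_pi.trans (forall_congr' fun i => ?_)
  exact hasDerivWithinAt_pi.trans (forall_congr' fun k => hasDerivWithinAt_pi)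

lemma reflect {f : ℝ → ℝ} {a T t : ℝ} (h : HasDerivWithinAt f a (Icc 0 T) (T - t)) :
    HasDerivWithinAt (fun s => f (T - s)) (-a) (Icc 0 T) t := by
  have h1 : HasDerivWithinAt (fun s : ℝ => T - s) (-1) (Icc 0 T) t := by
    simpa using (hasDerivWithinAt_id t (Icc 0 T)).const_sub T
  have h2 := h.comp t h1 fun s hs => ⟨by linarith [hs.2], by linarith [hs.1]⟩
  simpa [Function.comp_def] using h2

lemma backward (hd : d.Good) {G : M → Matrix (Fin n) (Fin n) ℝ} (hG : ∀ i, (G i).PosSemidef)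
    {T : ℝ} (hT : 0 < T) : ∃ P : ℝ → M → Matrix (Fin n) (Fin n) ℝ,
      ((∀ i, P T i = G i) ∧ (∀ i, ∀ t ∈ Icc (0:ℝ) T, (P t i).PosSemidef) ∧
        ∀ i, ∀ t ∈ Icc (0:ℝ) T, ∀ k l,
          HasDerivWithinAt (fun s => P s i k l) ((-(d.F (P t) i)) k l) (Icc 0 T) t) ∧
      ∀ P' : ℝ → M → Matrix (Fin n) (Fin n) ℝ,
        ((∀ i, P' T i = G i) ∧ (∀ i, ∀ t ∈ Icc (0:ℝ) T, (P' t i).PosSemidef) ∧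
        ∀ i, ∀ t ∈ Icc (0:ℝ) T, ∀ k l,
          HasDerivWithinAt (fun s => P' s i k l) ((-(d.F (P' t) i)) k l) (Icc 0 T) t) →
        ∀ t ∈ Icc (0:ℝ) T, ∀ i, P' t i = P t i := by
  obtain ⟨X, ⟨h0, hp, hX⟩, hu⟩ := forward hd hG hT
  have hmem : ∀ t ∈ Icc (0:ℝ) T, T - t ∈ Icc (0:ℝ) T := fun t ht =>
    ⟨by linarith [ht.2], by linarith [ht.1]⟩
  refine ⟨fun t => X (T - t), ⟨fun i => by simp [h0], fun i t ht => hp _ (hmem t ht) i,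
    fun i t ht k l => ?_⟩, fun P' ⟨hT', hp', hd'⟩ t ht i => ?_⟩
  · exact reflect (f := fun s => X s i k l) (deriv_iff.1 (hX _ (hmem t ht)) i k l)
  · have := hu (fun t => P' (T - t)) ⟨by funext i; simp [hT' i],
      fun t ht i => hp' i _ (hmem t ht), fun t ht => deriv_iff.2 fun i k l => ?_⟩ (T - t)
      (hmem t ht)
    · simpa using congrFun this i
    · have h1 := reflect (f := fun s => P' s i k l) (hd' i _ (hmem t ht) k l)
      rwa [Matrix.neg_apply, neg_neg] at h1

end Dynamics
end RicData

/-- Under `Q₁(i) ≥ 0`, `N₁(i) > 0`, `G₁(i) ≥ 0`, the coupled symmetric matrix Riccati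
equations with regime switching
`dP₁(t,i)/dt = −[P₁A + AᵀP₁ + CᵀP₁C + Q₁ − S₁ᵀÑ₁⁻¹S₁ + Σ_j λ_ij(P₁(t,j) − P₁(t,i))]`,
`P₁(T,i) = G₁(i)`, with `Ñ₁ = N₁ + D₁ᵀP₁D₁` and `S₁ = B₁ᵀP₁ + D₁ᵀP₁C`, admit a solution
on `[0,T]` which is positive semidefinite for each `i`, and this solution is unique. -/
theorem riccati_follower_exists_unique
    {n m : ℕ} {M : Type*} [Fintype M]
    (T : ℝ) (hT : 0 < T)
    (lam : M → M → ℝ) (hlam_nonneg : ∀ i j, i ≠ j → 0 ≤ lam i j)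
    (hlam_sum : ∀ i, (∑ j, lam i j) = 0)
    (A C : M → Matrix (Fin n) (Fin n) ℝ)
    (B₁ D₁ : M → Matrix (Fin n) (Fin m) ℝ)
    (Q₁ G₁ : M → Matrix (Fin n) (Fin n) ℝ)
    (N₁ : M → Matrix (Fin m) (Fin m) ℝ)
    (hQ₁ : ∀ i, (Q₁ i).PosSemidef) (hN₁ : ∀ i, (N₁ i).PosDef)
    (hG₁ : ∀ i, (G₁ i).PosSemidef) :
    ∃ P : ℝ → M → Matrix (Fin n) (Fin n) ℝ,
      ((∀ i, P T i = G₁ i)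
      ∧ (∀ i, ∀ t ∈ Set.Icc (0:ℝ) T, (P t i).PosSemidef)
      ∧ (∀ i, ∀ t ∈ Set.Icc (0:ℝ) T, ∀ k l,
          HasDerivWithinAt (fun s => P s i k l)
            ((-(P t i * A i + (A i)ᵀ * P t i + (C i)ᵀ * P t i * C i + Q₁ i
              - ((B₁ i)ᵀ * P t i + (D₁ i)ᵀ * P t i * C i)ᵀ
                * (N₁ i + (D₁ i)ᵀ * P t i * D₁ i)⁻¹
                * ((B₁ i)ᵀ * P t i + (D₁ i)ᵀ * P t i * C i)
              + ∑ j, lam i j • (P t j - P t i))) k l)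
            (Set.Icc (0:ℝ) T) t))
      ∧ ∀ P' : ℝ → M → Matrix (Fin n) (Fin n) ℝ,
          ((∀ i, P' T i = G₁ i)
          ∧ (∀ i, ∀ t ∈ Set.Icc (0:ℝ) T, (P' t i).PosSemidef)
          ∧ (∀ i, ∀ t ∈ Set.Icc (0:ℝ) T, ∀ k l,
              HasDerivWithinAt (fun s => P' s i k l)
                ((-(P' t i * A i + (A i)ᵀ * P' t i + (C i)ᵀ * P' t i * C i + Q₁ i
                  - ((B₁ i)ᵀ * P' t i + (D₁ i)ᵀ * P' t i * C i)ᵀ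
                    * (N₁ i + (D₁ i)ᵀ * P' t i * D₁ i)⁻¹
                    * ((B₁ i)ᵀ * P' t i + (D₁ i)ᵀ * P' t i * C i)
                  + ∑ j, lam i j • (P' t j - P' t i))) k l)
                (Set.Icc (0:ℝ) T) t)) →
          ∀ t ∈ Set.Icc (0:ℝ) T, ∀ i, P' t i = P t i := by
  exact RicData.backward
    (d := { lam := lam, A := A, C := C, B := B₁, D := D₁, Q := Q₁, N := N₁ })
    ⟨hlam_nonneg, hQ₁, hN₁⟩ hG₁ hT
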